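/- Let n ≥ 2 and 1 ≤ k ≤ n. Every k-producible n-partite correlation p with 2 inputs and 2 outcomes per party satisfies ∑_{1 ≤ i < j ≤ n} I^{i,j}_{0|0}(p) ≤ [⌊n/k⌋·C(k,2) + C(n mod k, 2)]·p(0|0), where C(·,2) denotes the binomial coefficient and 0 is the all-zero tuple. -/

import Mathlib

/-- A non-signaling correlation with `d` outcomes and `m` inputs per party, for a
finite set `ι` of parties: nonnegative, normalized, and non-signaling. -/
def IsNSCorr {ι : Type} [Fintype ι] [DecidableEq ι] (d m : ℕ)
    (p : (ι → Fin d) → (ι → Fin m) → ℝ) : Prop :=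
  (∀ a x, 0 ≤ p a x) ∧ (∀ x, ∑ a : ι → Fin d, p a x = 1) ∧
  (∀ (i : ι) (a : ι → Fin d) (x x' : ι → Fin m), (∀ j, j ≠ i → x j = x' j) →
    ∑ v : Fin d, p (Function.update a i v) x = ∑ v : Fin d, p (Function.update a i v) x')

/-- `p` is local across the bipartition `S | Sᶜ` of the `n` parties. -/
def IsLocalAcross (n d m : ℕ) (S : Finset (Fin n))
    (p : (Fin n → Fin d) → (Fin n → Fin m) → ℝ) : Prop :=
  ∃ (N : ℕ) (q : Fin N → ℝ)
    (pS : Fin N → ({i : Fin n // i ∈ S} → Fin d) → ({i : Fin n // i ∈ S} → Fin m) → ℝ)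
    (pT : Fin N → ({i : Fin n // i ∉ S} → Fin d) → ({i : Fin n // i ∉ S} → Fin m) → ℝ),
    (∀ l, 0 ≤ q l) ∧ (∑ l, q l = 1) ∧
    (∀ l, IsNSCorr d m (pS l)) ∧ (∀ l, IsNSCorr d m (pT l)) ∧
    (∀ a x, p a x =
      ∑ l, q l * pS l (fun i => a i.1) (fun i => x i.1) * pT l (fun i => a i.1) (fun i => x i.1))

/-- `p` is bilocal: a convex combination of correlations, each local across some
nontrivial bipartition. -/
def IsBilocal (n d m : ℕ) (p : (Fin n → Fin d) → (Fin n → Fin m) → ℝ) : Prop :=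
  ∃ (N : ℕ) (q : Fin N → ℝ)
    (ps : Fin N → (Fin n → Fin d) → (Fin n → Fin m) → ℝ) (S : Fin N → Finset (Fin n)),
    (∀ l, 0 ≤ q l) ∧ (∑ l, q l = 1) ∧
    (∀ l, (S l).Nonempty ∧ S l ≠ Finset.univ ∧ IsLocalAcross n d m (S l) (ps l)) ∧
    (∀ a x, p a x = ∑ l, q l * ps l a x)

/-- `p` is a mixture of products over the blocks (the fibers) of the partition
function `π`. -/
def IsProdForPartition (n d m : ℕ) (π : Fin n → Fin n)
    (p : (Fin n → Fin d) → (Fin n → Fin m) → ℝ) : Prop :=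
  ∃ (N : ℕ) (q : Fin N → ℝ)
    (pB : Fin N → (t : Fin n) →
      ({i : Fin n // π i = t} → Fin d) → ({i : Fin n // π i = t} → Fin m) → ℝ),
    (∀ l, 0 ≤ q l) ∧ (∑ l, q l = 1) ∧
    (∀ l t, IsNSCorr d m (pB l t)) ∧
    (∀ a x, p a x = ∑ l, q l * ∏ t : Fin n, pB l t (fun i => a i.1) (fun i => x i.1))

/-- `p` is `k`-producible: a convex combination of correlations, each a mixture of
products over the blocks of a partition of the parties into blocks of size at most `k`. -/
def IsKProducible (n d m k : ℕ) (p : (Fin n → Fin d) → (Fin n → Fin m) → ℝ) : Prop :=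
  ∃ (N : ℕ) (q : Fin N → ℝ)
    (ps : Fin N → (Fin n → Fin d) → (Fin n → Fin m) → ℝ) (π : Fin N → (Fin n → Fin n)),
    (∀ l, 0 ≤ q l) ∧ (∑ l, q l = 1) ∧
    (∀ l, (∀ t, (Finset.univ.filter (fun i => π l i = t)).card ≤ k) ∧
      IsProdForPartition n d m (π l) (ps l)) ∧
    (∀ a x, p a x = ∑ l, q l * ps l a x)

/-- The value of the Bell expression with coefficients `β` on the correlation `p`. -/
def BellApply {n d m : ℕ} (β : (Fin n → Fin d) → (Fin n → Fin m) → ℝ)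
    (p : (Fin n → Fin d) → (Fin n → Fin m) → ℝ) : ℝ :=
  ∑ a, ∑ x, β a x * p a x


/-- The outcome/input tuple with a single `1` at position `i` and `0` elsewhere. -/
def unitVec (n : ℕ) (i : Fin n) : Fin n → Fin 2 :=
  Function.update (fun _ => 0) i 1

/-- The lifted CHSH expression `I^{i,j}_{0|0}(p) =
p(0|0) − p(eᵢ|eᵢ) − p(eⱼ|eⱼ) − p(0|eᵢ+eⱼ)`. -/
def chshLift {n : ℕ} (i j : Fin n) (p : (Fin n → Fin 2) → (Fin n → Fin 2) → ℝ) : ℝ :=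
  p (fun _ => 0) (fun _ => 0) - p (unitVec n i) (unitVec n i)
    - p (unitVec n j) (unitVec n j)
    - p (fun _ => 0) (Function.update (unitVec n i) j 1)

open Finset in
/-- The pairs `i < j` of elements of `s` are counted by `(#s).choose 2`. -/
theorem card_filter_lt_product {α : Type*} [LinearOrder α] (s : Finset α) :
    ((s ×ˢ s).filter (fun q => q.1 < q.2)).card = s.card.choose 2 := by
  induction s using Finset.induction_on_max with
  | empty => simp
  | insert a s hmax ih =>
    have ha : a ∉ s := fun h => lt_irrefl _ (hmax a h)
    have hsplit : ((insert a s ×ˢ insert a s).filter (fun q => q.1 < q.2)) =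
        ((s ×ˢ s).filter (fun q => q.1 < q.2)) ∪ s ×ˢ {a} := by
      ext ⟨x, y⟩
      simp only [mem_filter, mem_product, mem_insert, mem_union, mem_singleton]
      constructor
      · rintro ⟨⟨rfl | hx, rfl | hy⟩, h⟩
        · exact absurd h (lt_irrefl _)
        · exact absurd h (hmax y hy).not_gt
        · exact Or.inr ⟨hx, rfl⟩
        · exact Or.inl ⟨⟨hx, hy⟩, h⟩
      · rintro (⟨⟨hx, hy⟩, h⟩ | ⟨hx, rfl⟩)
        · exact ⟨⟨Or.inr hx, Or.inr hy⟩, h⟩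
        · exact ⟨⟨Or.inr hx, Or.inl rfl⟩, hmax x hx⟩
    have hdisj : Disjoint ((s ×ˢ s).filter (fun q => q.1 < q.2)) (s ×ˢ {a}) := by
      rw [disjoint_left]
      rintro ⟨x, y⟩ h h'
      simp only [mem_filter, mem_product, mem_singleton] at h h'
      exact ha (h'.2 ▸ h.1.2)
    rw [hsplit, card_union_of_disjoint hdisj, ih, card_product, card_singleton, mul_one,
      card_insert_of_notMem ha, Nat.choose_succ_succ' s.card 1, Nat.choose_one_right, add_comm]

/-- Convexity of `m ↦ m.choose 2`. -/
theorem choose_two_add_le_of_le {s r : ℕ} (u : ℕ) (h : s ≤ r) :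
    (s + u).choose 2 + r.choose 2 ≤ (r + u).choose 2 + s.choose 2 := by
  have key : ((s + u).choose 2 + r.choose 2 : ℝ) ≤ (r + u).choose 2 + s.choose 2 := by
    rw [Nat.cast_choose_two, Nat.cast_choose_two, Nat.cast_choose_two, Nat.cast_choose_two]
    push_cast
    nlinarith [mul_nonneg (sub_nonneg.2 (Nat.cast_le (α := ℝ).2 h)) (Nat.cast_nonneg (α := ℝ) u)]
  exact_mod_cast key

theorem choose_two_add_greedy_le {k c : ℕ} (hk : 1 ≤ k) (hc : c ≤ k) (m : ℕ) :
    c.choose 2 + (m / k * k.choose 2 + (m % k).choose 2) ≤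
      (c + m) / k * k.choose 2 + ((c + m) % k).choose 2 := by
  have hr : m % k < k := Nat.mod_lt _ hk
  have hm : m = m % k + k * (m / k) := (Nat.mod_add_div m k).symm
  generalize m % k = r at *
  generalize m / k = q at *
  subst hm
  rw [← add_assoc c, Nat.add_mul_div_left _ _ hk, Nat.add_mul_mod_self_left]
  rcases lt_or_ge (c + r) k with h | h
  · rw [Nat.div_eq_of_lt h, Nat.mod_eq_of_lt h, zero_add]
    have := choose_two_add_le_of_le c (Nat.zero_le r)
    rw [zero_add, Nat.choose_zero_succ, add_comm r c] at this
    omega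
  · obtain ⟨s, hs⟩ := Nat.exists_eq_add_of_le h
    have hsk : s < k := by omega
    rw [hs, Nat.add_div_left _ hk, Nat.add_mod_left, Nat.div_eq_of_lt hsk, Nat.mod_eq_of_lt hsk]
    have := choose_two_add_le_of_le (k - r) (show s ≤ r by omega)
    rw [show s + (k - r) = c by omega, show r + (k - r) = k by omega] at this
    linarith

/-- Among families of block sizes bounded by `k`, the number of pairs inside a common block is
largest when the blocks are filled greedily. -/
theorem sum_choose_two_le {ι : Type*} {k : ℕ} (hk : 1 ≤ k) (s : Finset ι) (c : ι → ℕ)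
    (hc : ∀ t ∈ s, c t ≤ k) :
    ∑ t ∈ s, (c t).choose 2 ≤
      (∑ t ∈ s, c t) / k * k.choose 2 + ((∑ t ∈ s, c t) % k).choose 2 := by
  classical
  induction s using Finset.induction_on with
  | empty => simp
  | insert a s ha ih =>
    rw [Finset.sum_insert ha, Finset.sum_insert ha]
    exact (Nat.add_le_add_left (ih fun t ht => hc t (Finset.mem_insert_of_mem ht)) _).trans
      (choose_two_add_greedy_le hk (hc a (Finset.mem_insert_self a s)) _)

open Finset in
theorem card_pairs_same_block_le {n k : ℕ} (hk : 1 ≤ k) (π : Fin n → Fin n)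
    (hπ : ∀ t, (univ.filter (fun i => π i = t)).card ≤ k) :
    ((univ.filter (fun q : Fin n × Fin n => q.1 < q.2)).filter
        (fun q => π q.1 = π q.2)).card ≤
      n / k * k.choose 2 + (n % k).choose 2 := by
  have hn : ∑ t, (univ.filter (fun i => π i = t)).card = n := by
    rw [← card_eq_sum_card_fiberwise (fun i _ => mem_univ (π i)), card_univ, Fintype.card_fin]
  have hle := sum_choose_two_le hk univ _ (fun t _ => hπ t)
  rw [hn] at hle
  refine le_trans (le_of_eq ?_) hle
  rw [card_eq_sum_card_fiberwise (f := fun q : Fin n × Fin n => π q.1) (t := univ)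
    (fun _ _ => mem_univ _)]
  refine sum_congr rfl fun t _ => ?_
  rw [← card_filter_lt_product]
  congr 1
  ext ⟨i, j⟩
  simp only [mem_filter, mem_product, mem_univ, true_and]
  constructor
  · rintro ⟨⟨h, h'⟩, rfl⟩
    exact ⟨⟨rfl, h'.symm⟩, h⟩
  · rintro ⟨⟨rfl, h'⟩, h⟩
    exact ⟨⟨h, h'.symm⟩, rfl⟩

theorem IsNSCorr.zero_le_add {ι : Type} [Fintype ι] [DecidableEq ι]
    {B : (ι → Fin 2) → (ι → Fin 2) → ℝ} (hB : IsNSCorr 2 2 B) (i : ι) :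
    B (fun _ => 0) (fun _ => 0) ≤ B (fun _ => 0) (Function.update (fun _ => 0) i 1) +
      B (Function.update (fun _ => 0) i 1) (Function.update (fun _ => 0) i 1) := by
  have h := hB.2.2 i (fun _ => 0) (fun _ => 0) (Function.update (fun _ => 0) i 1)
    (fun j hj => by rw [Function.update_of_ne hj])
  have h0 : Function.update (fun _ : ι => (0 : Fin 2)) i 0 = fun _ => 0 :=
    Function.update_eq_self i _
  simp only [Fin.sum_univ_two, h0] at h
  linarith [hB.1 (Function.update (fun _ => 0) i 1) (fun _ => 0)]

/-- The CHSH inequality in Eberhard form, for a product of two single-party behaviours. -/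
theorem eberhard_product_le {a₀ a₁ a' b₀ b₁ b' : ℝ} (ha₀ : 0 ≤ a₀) (ha₁ : 0 ≤ a₁) (ha' : 0 ≤ a')
    (hb₀ : 0 ≤ b₀) (hb₁ : 0 ≤ b₁) (hb' : 0 ≤ b')
    (ha : a₀ ≤ a₁ + a') (hb : b₀ ≤ b₁ + b') :
    a₀ * b₀ - a' * b₀ - a₀ * b' - a₁ * b₁ ≤ 0 := by
  rcases le_total a₀ a₁ with h | h
  · nlinarith [mul_nonneg ha' hb₀, mul_nonneg ha₀ (sub_nonneg.2 hb), mul_nonneg (sub_nonneg.2 h) hb₁]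
  · nlinarith [mul_nonneg (sub_nonneg.2 ha) hb₀, mul_nonneg ha₁ (sub_nonneg.2 hb),
      mul_nonneg (sub_nonneg.2 h) hb']

theorem restrict_update_of_eq {n : ℕ} {π : Fin n → Fin n} {t : Fin n} (i : Fin n) (h : π i = t)
    (f : Fin n → Fin 2) :
    (fun j : {j : Fin n // π j = t} => Function.update f i 1 j.1) =
      Function.update (fun j : {j : Fin n // π j = t} => f j.1) ⟨i, h⟩ 1 := by
  funext j
  simp only [Function.update_apply, Subtype.ext_iff]

theorem restrict_update_of_ne {n : ℕ} {π : Fin n → Fin n} {t : Fin n} (i : Fin n) (h : π i ≠ t)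
    (f : Fin n → Fin 2) :
    (fun j : {j : Fin n // π j = t} => Function.update f i 1 j.1) = fun j => f j.1 := by
  funext j
  exact Function.update_of_ne (fun hj => h ((congrArg π hj).symm.trans j.2)) _ _

theorem chshLift_le {n : ℕ} (i j : Fin n) {p : (Fin n → Fin 2) → (Fin n → Fin 2) → ℝ}
    (hp : ∀ a x, 0 ≤ p a x) : chshLift i j p ≤ p (fun _ => 0) (fun _ => 0) := by
  unfold chshLift
  linarith [hp (unitVec n i) (unitVec n i), hp (unitVec n j) (unitVec n j),
    hp (fun _ => 0) (Function.update (unitVec n i) j 1)]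

theorem chshLift_sum {n N : ℕ} (i j : Fin n) (q : Fin N → ℝ)
    {p : (Fin n → Fin 2) → (Fin n → Fin 2) → ℝ}
    {ps : Fin N → (Fin n → Fin 2) → (Fin n → Fin 2) → ℝ}
    (hp : ∀ a x, p a x = ∑ l, q l * ps l a x) :
    chshLift i j p = ∑ l, q l * chshLift i j (ps l) := by
  simp only [chshLift, hp, mul_sub, Finset.sum_sub_distrib]

/-- A product correlation does not violate the lifted CHSH inequality for two parties in
different blocks. -/
theorem chshLift_prod_nonpos {n : ℕ} {π : Fin n → Fin n}
    {B : (t : Fin n) → ({i : Fin n // π i = t} → Fin 2) → ({i : Fin n // π i = t} → Fin 2) → ℝ}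
    (hB : ∀ t, IsNSCorr 2 2 (B t)) {i j : Fin n} (hij : π i ≠ π j) :
    chshLift i j (fun a x => ∏ t : Fin n, B t (fun l => a l.1) (fun l => x l.1)) ≤ 0 := by
  have hsplit : ∀ f : Fin n → ℝ, ∏ t, f t =
      f (π i) * f (π j) * ∏ t ∈ (Finset.univ.erase (π i)).erase (π j), f t := fun f => by
    rw [← Finset.mul_prod_erase _ f (Finset.mem_univ (π i)),
      ← Finset.mul_prod_erase _ f (Finset.mem_erase.2 ⟨hij.symm, Finset.mem_univ (π j)⟩),
      mul_assoc]
  set R := ∏ t ∈ (Finset.univ.erase (π i)).erase (π j), B t (fun _ => 0) (fun _ => 0) with hR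
  have hR0 : 0 ≤ R := Finset.prod_nonneg fun t _ => (hB t).1 _ _
  have hrest : ∀ a x : Fin n → Fin 2,
      (∀ l, l ≠ i → l ≠ j → a l = 0) → (∀ l, l ≠ i → l ≠ j → x l = 0) →
      ∏ t ∈ (Finset.univ.erase (π i)).erase (π j), B t (fun l => a l.1) (fun l => x l.1) = R := by
    intro a x ha hx
    refine Finset.prod_congr rfl fun t ht => ?_
    simp only [Finset.mem_erase] at ht
    have hi : ∀ l : {l : Fin n // π l = t}, l.1 ≠ i := fun l h => ht.2.1 (h ▸ l.2).symm
    have hj : ∀ l : {l : Fin n // π l = t}, l.1 ≠ j := fun l h => ht.1 (h ▸ l.2).symm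
    congr 1
    · exact funext fun l => ha _ (hi l) (hj l)
    · exact funext fun l => hx _ (hi l) (hj l)
  have hu : ∀ l, l ≠ i → l ≠ j → unitVec n i l = 0 := fun l hi _ => by
    simp [unitVec, hi]
  have hv : ∀ l, l ≠ i → l ≠ j → unitVec n j l = 0 := fun l _ hj => by
    simp [unitVec, hj]
  have huv : ∀ l, l ≠ i → l ≠ j → Function.update (unitVec n i) j 1 l = 0 := fun l hi hj => by
    simp [unitVec, hi, hj]
  unfold chshLift
  simp only [hsplit]
  rw [hrest _ _ hu hu, hrest _ _ hv hv, hrest _ _ (fun _ _ _ => rfl) huv]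
  simp only [unitVec, restrict_update_of_eq i rfl, restrict_update_of_eq j rfl,
    restrict_update_of_ne i hij, restrict_update_of_ne j hij.symm]
  have key := eberhard_product_le ((hB (π i)).1 (fun _ => 0) (fun _ => 0))
    ((hB (π i)).1 _ _) ((hB (π i)).1 _ _) ((hB (π j)).1 (fun _ => 0) (fun _ => 0))
    ((hB (π j)).1 _ _) ((hB (π j)).1 _ _) ((hB (π i)).zero_le_add ⟨i, rfl⟩) ((hB (π j)).zero_le_add ⟨j, rfl⟩)
  nlinarith [mul_nonneg hR0 (neg_nonneg.2 key)]

/-- The bound for a single product over the blocks of a partition. -/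
theorem sum_chshLift_prod_le {n k : ℕ} (hk : 1 ≤ k) {π : Fin n → Fin n}
    (hπ : ∀ t, (Finset.univ.filter (fun i => π i = t)).card ≤ k)
    {B : (t : Fin n) → ({i : Fin n // π i = t} → Fin 2) → ({i : Fin n // π i = t} → Fin 2) → ℝ}
    (hB : ∀ t, IsNSCorr 2 2 (B t)) :
    ∑ q ∈ Finset.univ.filter (fun q : Fin n × Fin n => q.1 < q.2),
        chshLift q.1 q.2 (fun a x => ∏ t : Fin n, B t (fun l => a l.1) (fun l => x l.1)) ≤
      ((n / k * Nat.choose k 2 + Nat.choose (n % k) 2 : ℕ) : ℝ) *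
        ∏ t : Fin n, B t (fun _ => 0) (fun _ => 0) := by
  have hp : ∀ a x : Fin n → Fin 2, 0 ≤ ∏ t : Fin n, B t (fun l => a l.1) (fun l => x l.1) :=
    fun a x => Finset.prod_nonneg fun t _ => (hB t).1 _ _
  rw [← Finset.sum_filter_add_sum_filter_not _ (fun q : Fin n × Fin n => π q.1 = π q.2)]
  refine (add_le_add (Finset.sum_le_card_nsmul _ _ _ fun q _ => chshLift_le q.1 q.2 hp)
    (Finset.sum_nonpos fun q hq => chshLift_prod_nonpos hB (Finset.mem_filter.1 hq).2)).trans ?_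
  rw [add_zero, nsmul_eq_mul]
  exact mul_le_mul_of_nonneg_right (Nat.cast_le.2 (card_pairs_same_block_le hk π hπ))
    (hp (fun _ => 0) (fun _ => 0))

/-- The set of behaviours satisfying the bound is convex. -/
theorem sum_chshLift_le_of_convex {n N : ℕ} (s : Finset (Fin n × Fin n)) (C : ℝ) {q : Fin N → ℝ}
    (hq : ∀ l, 0 ≤ q l) {p : (Fin n → Fin 2) → (Fin n → Fin 2) → ℝ}
    {ps : Fin N → (Fin n → Fin 2) → (Fin n → Fin 2) → ℝ}
    (hp : ∀ a x, p a x = ∑ l, q l * ps l a x)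
    (hps : ∀ l, ∑ r ∈ s, chshLift r.1 r.2 (ps l) ≤ C * ps l (fun _ => 0) (fun _ => 0)) :
    ∑ r ∈ s, chshLift r.1 r.2 p ≤ C * p (fun _ => 0) (fun _ => 0) := by
  simp only [chshLift_sum _ _ q hp, hp, Finset.mul_sum]
  rw [Finset.sum_comm]
  refine Finset.sum_le_sum fun l _ => ?_
  rw [← Finset.mul_sum, mul_left_comm]
  exact mul_le_mul_of_nonneg_left (hps l) (hq l)

/-- every `k`-producible `n`-partite correlation (2 inputs / 2 outcomes
per party) satisfies
`∑_{i<j} I^{i,j}_{0|0}(p) ≤ [⌊n/k⌋ C(k,2) + C(n mod k, 2)] p(0|0)`. -/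
theorem statement7 (n k : ℕ) (hn : 2 ≤ n) (hk : 1 ≤ k) (hkn : k ≤ n)
    (p : (Fin n → Fin 2) → (Fin n → Fin 2) → ℝ)
    (hp : IsKProducible n 2 2 k p) :
    ∑ q ∈ Finset.univ.filter (fun q : Fin n × Fin n => q.1 < q.2),
        chshLift q.1 q.2 p ≤
      ((n / k * Nat.choose k 2 + Nat.choose (n % k) 2 : ℕ) : ℝ) *
        p (fun _ => 0) (fun _ => 0) := by
  obtain ⟨N, q, ps, π, hq, -, hps, hp⟩ := hp
  refine sum_chshLift_le_of_convex _ _ hq hp fun l => ?_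
  obtain ⟨hπ, M, w, B, hw, -, hB, hprod⟩ := hps l
  exact sum_chshLift_le_of_convex _ _ hw hprod fun m => sum_chshLift_prod_le hk hπ (hB m)
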